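/- Let R be a commutative ring, M a finite free R-module equipped with a perfect alternating bilinear form B, and N ⊆ M a submodule which is a direct summand of M. Then the orthogonal N^⊥ = {x ∈ M : B(x, n) = 0 for all n ∈ N} is also a direct summand of M. -/

import Mathlib

/-- The orthogonal of a submodule `N` with respect to a bilinear form `B`:
`N^⊥ = {x ∈ M : B(x, n) = 0 for all n ∈ N}`. -/
def bilinOrthogonal {R M : Type*} [CommRing R] [AddCommGroup M] [Module R M]
    (B : M →ₗ[R] M →ₗ[R] R) (N : Submodule R M) : Submodule R M where
  carrier := {x | ∀ n ∈ N, B x n = 0}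
  add_mem' := by
    intro a b ha hb n hn
    simp [map_add, ha n hn, hb n hn]
  zero_mem' := by
    intro n hn
    simp
  smul_mem' := by
    intro c x hx n hn
    simp [map_smul, hx n hn]

/-- A perfect bilinear form sends complementary submodules to complementary orthogonals. -/
theorem isCompl_bilinOrthogonal {R M : Type*} [CommRing R] [AddCommGroup M] [Module R M]
    {B : M →ₗ[R] M →ₗ[R] R} (hperf : Function.Bijective B) {N N' : Submodule R M}
    (h : IsCompl N N') : IsCompl (bilinOrthogonal B N) (bilinOrthogonal B N') := by
  constructor
  · rw [Submodule.disjoint_def]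
    intro x hx hx'
    apply hperf.1
    rw [map_zero, ← LinearMap.ofIsCompl_zero h]
    exact (LinearMap.ofIsCompl_eq h (fun u => (hx u u.2).symm) fun u => (hx' u u.2).symm).symm
  · rw [codisjoint_iff, Submodule.eq_top_iff']
    intro x
    obtain ⟨y, hy⟩ := hperf.2 (LinearMap.ofIsCompl h 0 (B x ∘ₗ N'.subtype))
    refine Submodule.mem_sup.2 ⟨y, fun n hn => ?_, x - y, fun n hn => ?_, add_sub_cancel y x⟩
    · rw [hy]
      exact LinearMap.ofIsCompl_apply_left (φ := 0) h ⟨n, hn⟩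
    · rw [map_sub, LinearMap.sub_apply, hy, sub_eq_zero]
      exact (LinearMap.ofIsCompl_apply_right (ψ := B x ∘ₗ N'.subtype) h ⟨n, hn⟩).symm

/-- Let `R` be a commutative ring, `M` a finite free `R`-module equipped with
a perfect alternating bilinear form `B`, and `N ⊆ M` a direct summand. Then the orthogonal
`N^⊥` is also a direct summand of `M`. -/
theorem flatness_stmt_4 (R : Type*) [CommRing R]
    (M : Type*) [AddCommGroup M] [Module R M] [Module.Free R M] [Module.Finite R M]
    (B : M →ₗ[R] M →ₗ[R] R)
    (halt : ∀ x, B x x = 0) (hperf : Function.Bijective B)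
    (N : Submodule R M) (hN : ∃ N' : Submodule R M, IsCompl N N') :
    ∃ N'' : Submodule R M, IsCompl (bilinOrthogonal B N) N'' := by
  obtain ⟨N', h⟩ := hN
  exact ⟨bilinOrthogonal B N', isCompl_bilinOrthogonal hperf h⟩
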